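/- arXiv:2205.08940 — 7 statements merged into one kernel-verified Lean document; each statement's English description precedes it below -/
import Mathlib

section
/- Let Ω be a state space and ω, σ ∈ Ω. Then F(ω, σ) = 1 if and only if ω = σ. -/
open scoped BigOperators

/-- A state space: a compact convex subset `Ω` of a finite-dimensional real vector space `V`
which spans `V` and whose affine hull does not contain the origin. -/
def IsStateSpace {V : Type*} [NormedAddCommGroup V] [NormedSpace ℝ V] (Ω : Set V) : Prop :=
  IsCompact Ω ∧ Convex ℝ Ω ∧ Submodule.span ℝ Ω = ⊤ ∧ (0 : V) ∉ (affineSpan ℝ Ω : Set V)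

/-- An effect on `Ω`: a linear functional taking values in `[0,1]` on `Ω`. -/
def IsEffect {V : Type*} [AddCommGroup V] [Module ℝ V] (Ω : Set V) (e : V →ₗ[ℝ] ℝ) : Prop :=
  ∀ ω ∈ Ω, e ω ∈ Set.Icc (0 : ℝ) 1

/-- The unit effect on `Ω`: the linear functional equal to `1` on `Ω`. -/
def IsUnitEffect {V : Type*} [AddCommGroup V] [Module ℝ V] (Ω : Set V)
    (u : V →ₗ[ℝ] ℝ) : Prop :=
  ∀ ω ∈ Ω, u ω = 1

/-- An observable on `Ω`: a finite family of effects summing to the unit effect. -/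
def IsObservable {V : Type*} [AddCommGroup V] [Module ℝ V] (Ω : Set V) {X : Type*} [Fintype X]
    (e : X → (V →ₗ[ℝ] ℝ)) : Prop :=
  (∀ x, IsEffect Ω (e x)) ∧ ∀ ω ∈ Ω, ∑ x, e x ω = 1

/-- The fidelity of two states `ω, σ ∈ Ω`: the infimum over all observables `{e_x}` on `Ω`
of `∑ x, √(e_x ω) · √(e_x σ)`. -/
noncomputable def fidelity {V : Type*} [AddCommGroup V] [Module ℝ V] (Ω : Set V)
    (ω σ : V) : ℝ :=
  sInf { r | ∃ (nn : ℕ) (e : Fin nn → (V →ₗ[ℝ] ℝ)), IsObservable Ω e ∧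
    r = ∑ x, Real.sqrt (e x ω) * Real.sqrt (e x σ) }

theorem IsStateSpace.exists_isUnitEffect {V : Type*} [NormedAddCommGroup V] [NormedSpace ℝ V]
    {Ω : Set V} (hΩ : IsStateSpace Ω) {p : V} (hp : p ∈ Ω) :
    ∃ u : V →ₗ[ℝ] ℝ, IsUnitEffect Ω u := by
  have hpA : p ∈ affineSpan ℝ Ω := subset_affineSpan ℝ Ω hp
  have hpd : p ∉ (affineSpan ℝ Ω).direction := fun h => hΩ.2.2.2 <| by
    simpa using AffineSubspace.vadd_mem_of_mem_direction (neg_mem h) hpA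
  obtain ⟨f, hfp, hf⟩ := Submodule.exists_le_ker_of_notMem hpd
  refine ⟨(f p)⁻¹ • f, fun ω hω => ?_⟩
  have hker : f (ω - p) = 0 :=
    hf (AffineSubspace.vsub_mem_direction (subset_affineSpan ℝ Ω hω) hpA)
  rw [map_sub, sub_eq_zero] at hker
  simp [hker, hfp]

/-- The two-outcome observable `{e, u - e}`. -/
theorem IsEffect.isObservable_pair {V : Type*} [AddCommGroup V] [Module ℝ V] {Ω : Set V}
    {u e : V →ₗ[ℝ] ℝ} (he : IsEffect Ω e) (hu : IsUnitEffect Ω u) :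
    IsObservable Ω ![e, u - e] := by
  refine ⟨fun x => ?_, fun ω hω => by simp [hu ω hω]⟩
  fin_cases x
  · exact he
  · intro ω hω
    have := he ω hω
    simp only [Set.mem_Icc] at this
    simp [hu ω hω, this.1, this.2]

theorem IsStateSpace.exists_isEffect_ne {V : Type*} [NormedAddCommGroup V] [NormedSpace ℝ V]
    {Ω : Set V} (hΩ : IsStateSpace Ω) {u : V →ₗ[ℝ] ℝ} (hu : IsUnitEffect Ω u)
    {ω σ : V} (hω : ω ∈ Ω) (hσ : σ ∈ Ω) (h : ω ≠ σ) :
    ∃ e : V →ₗ[ℝ] ℝ, IsEffect Ω e ∧ e ω ≠ e σ := by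
  obtain ⟨f, hf⟩ := SeparatingDual.exists_separating_of_ne (R := ℝ) h
  obtain ⟨C, hC⟩ := hΩ.1.exists_bound_of_continuousOn f.continuous.continuousOn
  have hpos : 0 < |C| + 1 := by positivity
  refine ⟨(1 / 2 : ℝ) • (u + (|C| + 1)⁻¹ • (f : V →ₗ[ℝ] ℝ)), fun τ hτ => ?_, fun heq => hf ?_⟩
  · have hb : |(|C| + 1)⁻¹ * f τ| ≤ 1 := by
      rw [abs_mul, abs_inv, abs_of_pos hpos, inv_mul_le_one₀ hpos]
      have := hC τ hτ
      rw [Real.norm_eq_abs] at this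
      linarith [le_abs_self C]
    obtain ⟨h1, h2⟩ := abs_le.1 hb
    simp only [LinearMap.smul_apply, LinearMap.add_apply, hu τ hτ, smul_eq_mul,
      ContinuousLinearMap.coe_coe, Set.mem_Icc]
    constructor <;> linarith
  · simpa [hu ω hω, hu σ hσ, hpos.ne'] using heq

theorem Real.sqrt_mul_sqrt_le_half_add {a b : ℝ} (ha : 0 ≤ a) (hb : 0 ≤ b) :
    √a * √b ≤ (a + b) / 2 := by
  nlinarith [sq_nonneg (√a - √b), Real.sq_sqrt ha, Real.sq_sqrt hb]

theorem Real.sqrt_mul_sqrt_lt_half_add {a b : ℝ} (ha : 0 ≤ a) (hb : 0 ≤ b) (h : a ≠ b) :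
    √a * √b < (a + b) / 2 := by
  have hne : √a - √b ≠ 0 := sub_ne_zero.2 fun hs => h ((Real.sqrt_inj ha hb).1 hs)
  nlinarith [sq_pos_of_ne_zero hne, Real.sq_sqrt ha, Real.sq_sqrt hb]

theorem fidelity_self {V : Type*} [AddCommGroup V] [Module ℝ V] {Ω : Set V}
    {u : V →ₗ[ℝ] ℝ} (hu : IsUnitEffect Ω u) {ω : V} (hω : ω ∈ Ω) : fidelity Ω ω ω = 1 := by
  have hsum : ∀ (n : ℕ) (e : Fin n → (V →ₗ[ℝ] ℝ)), IsObservable Ω e →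
      ∑ x, √(e x ω) * √(e x ω) = 1 := fun n e he => by
    rw [← he.2 ω hω]
    exact Finset.sum_congr rfl fun x _ => Real.mul_self_sqrt (he.1 x ω hω).1
  have heff : IsEffect Ω u := fun τ hτ => by simp [hu τ hτ]
  have hobs := heff.isObservable_pair hu
  have hset : { r | ∃ (n : ℕ) (e : Fin n → (V →ₗ[ℝ] ℝ)), IsObservable Ω e ∧
      r = ∑ x, √(e x ω) * √(e x ω) } = {1} := by
    ext r
    constructor
    · rintro ⟨n, e, he, rfl⟩
      exact hsum n e he
    · rintro rfl
      exact ⟨2, _, hobs, (hsum _ _ hobs).symm⟩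
  rw [fidelity, hset, csInf_singleton]

theorem fidelity_le_sum {V : Type*} [AddCommGroup V] [Module ℝ V] {Ω : Set V} (ω σ : V)
    {n : ℕ} {e : Fin n → (V →ₗ[ℝ] ℝ)} (he : IsObservable Ω e) :
    fidelity Ω ω σ ≤ ∑ x, √(e x ω) * √(e x σ) := by
  refine csInf_le ⟨0, ?_⟩ ⟨n, e, he, rfl⟩
  rintro r ⟨m, g, -, rfl⟩
  positivity

theorem fidelity_lt_one {V : Type*} [AddCommGroup V] [Module ℝ V] {Ω : Set V}
    {u e : V →ₗ[ℝ] ℝ} (hu : IsUnitEffect Ω u) (he : IsEffect Ω e) {ω σ : V}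
    (hω : ω ∈ Ω) (hσ : σ ∈ Ω) (h : e ω ≠ e σ) : fidelity Ω ω σ < 1 := by
  refine (fidelity_le_sum ω σ (he.isObservable_pair hu)).trans_lt ?_
  obtain ⟨h0, h1⟩ := he ω hω
  obtain ⟨k0, k1⟩ := he σ hσ
  have hlt := Real.sqrt_mul_sqrt_lt_half_add h0 k0 h
  have hle := Real.sqrt_mul_sqrt_le_half_add (sub_nonneg.2 h1) (sub_nonneg.2 k1)
  simp only [Fin.sum_univ_two, Matrix.cons_val_zero, Matrix.cons_val_one, LinearMap.sub_apply,
    hu ω hω, hu σ hσ]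
  linarith

/-- Fidelity equals `1` iff the two states coincide. -/
theorem fidelity_eq_one_iff {V : Type*} [NormedAddCommGroup V] [NormedSpace ℝ V]
    [FiniteDimensional ℝ V] (Ω : Set V) (hΩ : IsStateSpace Ω)
    (ω σ : V) (hω : ω ∈ Ω) (hσ : σ ∈ Ω) :
    fidelity Ω ω σ = 1 ↔ ω = σ := by
  obtain ⟨u, hu⟩ := hΩ.exists_isUnitEffect hω
  constructor
  · contrapose
    intro hne
    obtain ⟨e, he, hsep⟩ := hΩ.exists_isEffect_ne hu hω hσ hne
    exact (fidelity_lt_one hu he hω hσ hsep).ne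
  · rintro rfl
    exact fidelity_self hu hω
end

section
/- (Lemma 1) Let Ω_sys ⊆ V_sys and Ω_app ⊆ V_app be state spaces and Ω_tot a composite state space of Ω_sys and Ω_app. Let Λ be a reversible dynamics on Ω_tot, ξ a pure state of Ω_app, and α_ξ a reversible dynamics on Ω_sys. Suppose ω₁, ω₂ are distinct pure states of Ω_sys and ξ₁', ξ₂' are pure states of Ω_app such that Λ(ω₁ ⊗ ξ) = α_ξ(ω₁) ⊗ ξ₁' and Λ(ω₂ ⊗ ξ) = α_ξ(ω₂) ⊗ ξ₂'. If ω₁ and ω₂ are not perfectly distinguishable, then ξ₁' = ξ₂'. -/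
open scoped BigOperators

/-- The tensor product of two states, realized in the function space indexed by the
product of the index sets. -/
def tmul {ι₁ ι₂ : Type} (ω : ι₁ → ℝ) (σ : ι₂ → ℝ) : ι₁ × ι₂ → ℝ :=
  fun p => ω p.1 * σ p.2

/-- Auxiliary: partial application of a functional on the second factor. -/
def curryMap {ι₁ ι₂ : Type} (f : (ι₂ → ℝ) →ₗ[ℝ] ℝ) : (ι₁ × ι₂ → ℝ) →ₗ[ℝ] (ι₁ → ℝ) where
  toFun μ := fun i => f (fun j => μ (i, j))
  map_add' μ ν := by funext i; exact f.map_add _ _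
  map_smul' c μ := by funext i; exact f.map_smul c _

/-- The tensor product `e ⊗ f` of two effects, as a linear functional on the
composite space; it satisfies `(e ⊗ f)(ω ⊗ σ) = e ω · f σ`. -/
def etmul {ι₁ ι₂ : Type} (e : (ι₁ → ℝ) →ₗ[ℝ] ℝ) (f : (ι₂ → ℝ) →ₗ[ℝ] ℝ) :
    (ι₁ × ι₂ → ℝ) →ₗ[ℝ] ℝ :=
  e.comp (curryMap f)

/-- The linear map `β ⊗ id` on the composite space. -/
def lTensorId {ι₁ ι₂ : Type} (β : (ι₁ → ℝ) →ₗ[ℝ] (ι₁ → ℝ)) :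
    (ι₁ × ι₂ → ℝ) →ₗ[ℝ] (ι₁ × ι₂ → ℝ) where
  toFun μ := fun p => β (fun i => μ (i, p.2)) p.1
  map_add' μ ν := by funext p; exact congrFun (β.map_add _ _) p.1
  map_smul' c μ := by funext p; exact congrFun (β.map_smul c _) p.1

/-- The minimal tensor product of two state spaces: the convex hull of product states. -/
def minTensor {ι₁ ι₂ : Type} (Ω₁ : Set (ι₁ → ℝ)) (Ω₂ : Set (ι₂ → ℝ)) :
    Set (ι₁ × ι₂ → ℝ) :=
  convexHull ℝ {μ | ∃ ω ∈ Ω₁, ∃ σ ∈ Ω₂, μ = tmul ω σ}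

/-- The maximal tensor product of two state spaces: all `μ` normalized by the unit effects
and giving nonnegative probabilities on all product effects. -/
def maxTensor {ι₁ ι₂ : Type} (Ω₁ : Set (ι₁ → ℝ)) (Ω₂ : Set (ι₂ → ℝ)) :
    Set (ι₁ × ι₂ → ℝ) :=
  {μ | (∀ u₁ u₂, IsUnitEffect Ω₁ u₁ → IsUnitEffect Ω₂ u₂ → etmul u₁ u₂ μ = 1) ∧
    ∀ e f, IsEffect Ω₁ e → IsEffect Ω₂ f → 0 ≤ etmul e f μ}

/-- A composite state space of `Ω₁` and `Ω₂`: a compact convex set between the minimal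
and the maximal tensor products. -/
def IsComposite {ι₁ ι₂ : Type} [Fintype ι₁] [Fintype ι₂] (Ω₁ : Set (ι₁ → ℝ))
    (Ω₂ : Set (ι₂ → ℝ)) (Ωtot : Set (ι₁ × ι₂ → ℝ)) : Prop :=
  IsCompact Ωtot ∧ Convex ℝ Ωtot ∧ minTensor Ω₁ Ω₂ ⊆ Ωtot ∧ Ωtot ⊆ maxTensor Ω₁ Ω₂

/-- A program `ξ ∈ Ω_app` implements the dynamics `α` on `Ω_sys` through the dynamics `Λ`
on the composite: `(e ⊗ u_app)(Λ(ω ⊗ ξ)) = e(α ω)` for all states `ω` and effects `e`. -/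
def Implements {ι₁ ι₂ : Type} (Ωsys : Set (ι₁ → ℝ)) (Ωapp : Set (ι₂ → ℝ))
    (Λ : (ι₁ × ι₂ → ℝ) →ₗ[ℝ] (ι₁ × ι₂ → ℝ)) (ξ : ι₂ → ℝ)
    (α : (ι₁ → ℝ) →ₗ[ℝ] (ι₁ → ℝ)) : Prop :=
  ∀ ω ∈ Ωsys, ∀ e : (ι₁ → ℝ) →ₗ[ℝ] ℝ, IsEffect Ωsys e →
    ∀ u₂ : (ι₂ → ℝ) →ₗ[ℝ] ℝ, IsUnitEffect Ωapp u₂ →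
      etmul e u₂ (Λ (tmul ω ξ)) = e (α ω)

section StateSpace

variable {V : Type*}

theorem IsObservable.comp_mapsTo {W : Type*} [AddCommGroup V] [Module ℝ V] [AddCommGroup W]
    [Module ℝ W] {Ω : Set V} {Ω' : Set W} {X : Type*} [Fintype X] {e : X → (W →ₗ[ℝ] ℝ)}
    (he : IsObservable Ω' e) {f : V →ₗ[ℝ] W} (hf : Set.MapsTo f Ω Ω') :
    IsObservable Ω fun x => (e x).comp f :=
  ⟨fun x ω hω => he.1 x (f ω) (hf hω), fun ω hω => he.2 (f ω) (hf hω)⟩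

theorem fidelity_le [AddCommGroup V] [Module ℝ V] {Ω : Set V} (ω σ : V) {X : Type*} [Fintype X]
    {e : X → (V →ₗ[ℝ] ℝ)} (he : IsObservable Ω e) :
    fidelity Ω ω σ ≤ ∑ x, √(e x ω) * √(e x σ) := by
  refine csInf_le ⟨0, ?_⟩ ⟨Fintype.card X, fun i => e ((Fintype.equivFin X).symm i),
    ⟨fun i => he.1 _, fun τ hτ => ?_⟩, ?_⟩
  · rintro r ⟨nn, e, -, rfl⟩
    positivity
  · rw [← he.2 τ hτ]
    exact Equiv.sum_comp (Fintype.equivFin X).symm fun x => e x τ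
  · exact (Equiv.sum_comp (Fintype.equivFin X).symm fun x => √(e x ω) * √(e x σ)).symm

theorem le_fidelity [AddCommGroup V] [Module ℝ V] {Ω : Set V} {u : V →ₗ[ℝ] ℝ}
    (hu : IsUnitEffect Ω u) {ω σ : V} {c : ℝ}
    (h : ∀ (nn : ℕ) (e : Fin nn → (V →ₗ[ℝ] ℝ)), IsObservable Ω e →
      c ≤ ∑ x, √(e x ω) * √(e x σ)) :
    c ≤ fidelity Ω ω σ := by
  refine le_csInf ⟨_, 1, fun _ => u, ⟨fun _ τ hτ => ?_, fun τ hτ => ?_⟩, rfl⟩ ?_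
  · simp [hu τ hτ]
  · simp [hu τ hτ]
  · rintro r ⟨nn, e, he, rfl⟩
    exact h nn e he

variable [NormedAddCommGroup V] [NormedSpace ℝ V] {Ω : Set V}

theorem IsStateSpace.exists_isUnitEffect_s6 (h : IsStateSpace Ω) :
    ∃ u : V →ₗ[ℝ] ℝ, IsUnitEffect Ω u := by
  obtain rfl | ⟨p, hp⟩ := Ω.eq_empty_or_nonempty
  · exact ⟨0, fun _ hω => hω.elim⟩
  have hpA : p ∈ affineSpan ℝ Ω := subset_affineSpan ℝ Ω hp
  have hpD : p ∉ (affineSpan ℝ Ω).direction := fun hD => h.2.2.2 <| by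
    simpa using AffineSubspace.vadd_mem_of_mem_direction
      ((affineSpan ℝ Ω).direction.neg_mem hD) hpA
  obtain ⟨φ, hφp, hφ⟩ := Submodule.exists_le_ker_of_notMem hpD
  refine ⟨(φ p)⁻¹ • φ, fun ω hω => ?_⟩
  have hker : φ (ω - p) = 0 :=
    hφ (AffineSubspace.vsub_mem_direction (subset_affineSpan ℝ Ω hω) hpA)
  have : φ ω = φ p := by rwa [map_sub, sub_eq_zero] at hker
  simp [this, inv_mul_cancel₀ hφp]

theorem IsStateSpace.exists_effect_abs_le (h : IsStateSpace Ω) (v : V) :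
    ∃ C : ℝ, ∀ e : V →ₗ[ℝ] ℝ, IsEffect Ω e → |e v| ≤ C := by
  have hv : v ∈ Submodule.span ℝ Ω := h.2.2.1 ▸ Submodule.mem_top
  induction hv using Submodule.span_induction with
  | mem x hx =>
    exact ⟨1, fun e he => abs_le.2 ⟨by linarith [(he x hx).1], (he x hx).2⟩⟩
  | zero => exact ⟨0, fun e _ => by simp⟩
  | add x y _ _ hx hy =>
    obtain ⟨C, hC⟩ := hx
    obtain ⟨D, hD⟩ := hy
    refine ⟨C + D, fun e he => ?_⟩
    rw [map_add]
    exact (abs_add_le _ _).trans (add_le_add (hC e he) (hD e he))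
  | smul a x _ hx =>
    obtain ⟨C, hC⟩ := hx
    refine ⟨|a| * C, fun e he => ?_⟩
    rw [map_smul, smul_eq_mul, abs_mul]
    exact mul_le_mul_of_nonneg_left (hC e he) (abs_nonneg a)

/-- The effects of a state space form a compact set in the topology of pointwise convergence. -/
theorem IsStateSpace.isCompact_effects (h : IsStateSpace Ω) :
    IsCompact ((fun e : V →ₗ[ℝ] ℝ => (e : V → ℝ)) '' {e | IsEffect Ω e}) := by
  choose C hC using h.exists_effect_abs_le
  refine (isCompact_univ_pi fun v => isCompact_Icc (a := -C v) (b := C v)).of_isClosed_subset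
    ?_ ?_
  · have heq : (fun e : V →ₗ[ℝ] ℝ => (e : V → ℝ)) '' {e | IsEffect Ω e} =
        Set.range (fun e : V →ₗ[ℝ] ℝ => (e : V → ℝ)) ∩
          ⋂ ω ∈ Ω, {f : V → ℝ | f ω ∈ Set.Icc (0 : ℝ) 1} := by
      ext f
      simp only [Set.mem_image, Set.mem_inter_iff, Set.mem_range, Set.mem_iInter,
        Set.mem_ofPred_eq]
      constructor
      · rintro ⟨e, he, rfl⟩
        exact ⟨⟨e, rfl⟩, he⟩
      · rintro ⟨⟨e, rfl⟩, he⟩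
        exact ⟨e, he, rfl⟩
    rw [heq]
    exact (LinearMap.isClosed_range_coe V ℝ (RingHom.id ℝ)).inter
      (isClosed_biInter fun ω _ => isClosed_Icc.preimage (continuous_apply ω))
  · rintro _ ⟨e, he, rfl⟩ v -
    exact abs_le.1 (hC v e he)

/-- The fidelity of two states is positive unless they are perfectly distinguishable. -/
theorem IsStateSpace.fidelity_pos (h : IsStateSpace Ω) {ω σ : V} (hω : ω ∈ Ω) (hσ : σ ∈ Ω)
    (hnd : ¬ ∃ e : V →ₗ[ℝ] ℝ, IsEffect Ω e ∧ e ω = 1 ∧ e σ = 0) :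
    0 < fidelity Ω ω σ := by
  classical
  obtain ⟨u, hu⟩ := h.exists_isUnitEffect_s6
  obtain ⟨_, ⟨e₀, he₀, rfl⟩, hmax⟩ := h.isCompact_effects.exists_isMaxOn
    ⟨_, 0, fun _ _ => by simp, rfl⟩
    (((continuous_apply ω).sub (continuous_apply σ)).continuousOn (f := fun f : V → ℝ => f ω - f σ))
  have hlt : e₀ ω - e₀ σ < 1 := by
    by_contra! hge
    have h1 := he₀ ω hω
    have h2 := he₀ σ hσ
    simp only [Set.mem_Icc] at h1 h2
    exact hnd ⟨e₀, he₀, by linarith, by linarith⟩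
  refine (sub_pos.2 hlt).trans_le (le_fidelity hu fun nn e he => ?_)
  let S : Finset (Fin nn) := Finset.univ.filter fun x => e x σ ≤ e x ω
  have hsplit (τ : V) (hτ : τ ∈ Ω) : ∑ x ∈ S, e x τ + ∑ x ∈ Sᶜ, e x τ = 1 := by
    rw [Finset.sum_add_sum_compl, he.2 τ hτ]
  have hS : IsEffect Ω (∑ x ∈ S, e x) := fun τ hτ => by
    have h1 : 0 ≤ ∑ x ∈ S, e x τ := Finset.sum_nonneg fun x _ => (he.1 x τ hτ).1
    have h2 : 0 ≤ ∑ x ∈ Sᶜ, e x τ := Finset.sum_nonneg fun x _ => (he.1 x τ hτ).1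
    rw [LinearMap.sum_apply]
    exact ⟨h1, by linarith [hsplit τ hτ]⟩
  have hle : (∑ x ∈ S, e x) ω - (∑ x ∈ S, e x) σ ≤ e₀ ω - e₀ σ := hmax ⟨_, hS, rfl⟩
  rw [LinearMap.sum_apply, LinearMap.sum_apply] at hle
  have hmin {a b : ℝ} (ha : 0 ≤ a) (hab : a ≤ b) : a ≤ √a * √b := by
    calc a = √a * √a := (Real.mul_self_sqrt ha).symm
      _ ≤ √a * √b := by gcongr
  have hsum1 : ∑ x ∈ S, e x σ ≤ ∑ x ∈ S, √(e x ω) * √(e x σ) :=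
    Finset.sum_le_sum fun x hx => by
      rw [mul_comm]
      exact hmin (he.1 x σ hσ).1 (Finset.mem_filter.1 hx).2
  have hsum2 : ∑ x ∈ Sᶜ, e x ω ≤ ∑ x ∈ Sᶜ, √(e x ω) * √(e x σ) :=
    Finset.sum_le_sum fun x hx => by
      refine hmin (he.1 x ω hω).1 (le_of_not_ge fun hge => ?_)
      exact Finset.mem_compl.1 hx (Finset.mem_filter.2 ⟨Finset.mem_univ x, hge⟩)
  rw [← Finset.sum_add_sum_compl S]
  linarith [hsplit ω hω]

/-- A reversible dynamics does not increase the fidelity. -/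
theorem IsStateSpace.fidelity_map_le [FiniteDimensional ℝ V] (h : IsStateSpace Ω)
    {α : V →ₗ[ℝ] V} (hα : Set.BijOn α Ω Ω) (ω σ : V) :
    fidelity Ω (α ω) (α σ) ≤ fidelity Ω ω σ := by
  obtain ⟨u, hu⟩ := h.exists_isUnitEffect_s6
  have hsurj : Function.Surjective α := by
    rw [← LinearMap.range_eq_top, eq_top_iff, ← h.2.2.1, Submodule.span_le]
    exact fun τ hτ => let ⟨ρ, _, hρ⟩ := hα.surjOn hτ; ⟨ρ, hρ⟩
  let β := LinearEquiv.ofBijective α ⟨LinearMap.injective_iff_surjective.2 hsurj, hsurj⟩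
  have hβ (τ : V) : β.symm (α τ) = τ := β.symm_apply_apply τ
  have hmaps : Set.MapsTo (β.symm : V →ₗ[ℝ] V) Ω Ω := fun τ hτ => by
    obtain ⟨ρ, hρ, rfl⟩ := hα.surjOn hτ
    simpa [hβ] using hρ
  refine le_fidelity hu fun nn e he => ?_
  simpa [hβ] using fidelity_le (α ω) (α σ) (he.comp_mapsTo hmaps)

theorem IsStateSpace.exists_isEffect_ne_s6 [FiniteDimensional ℝ V] (h : IsStateSpace Ω) {ξ η : V}
    (hξ : ξ ∈ Ω) (hη : η ∈ Ω) (hne : ξ ≠ η) :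
    ∃ f : V →ₗ[ℝ] ℝ, IsEffect Ω f ∧ f ξ ≠ f η := by
  obtain ⟨u, hu⟩ := h.exists_isUnitEffect_s6
  obtain ⟨g, hg⟩ : ∃ g : V →ₗ[ℝ] ℝ, g (ξ - η) ≠ 0 := by
    by_contra! hall
    exact sub_ne_zero.2 hne ((Module.forall_dual_apply_eq_zero_iff ℝ _).1 hall)
  obtain ⟨C, hC⟩ := h.1.exists_bound_of_continuousOn g.continuous_of_finiteDimensional.continuousOn
  have hD : 0 < |C| + 1 := by positivity
  refine ⟨(2 * (|C| + 1))⁻¹ • (g + (|C| + 1) • u), fun τ hτ => ?_, fun heq => hg ?_⟩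
  · have hb := abs_le.1 ((Real.norm_eq_abs _ ▸ hC τ hτ).trans (le_abs_self C))
    simp only [LinearMap.smul_apply, LinearMap.add_apply, smul_eq_mul, hu τ hτ, mul_one]
    rw [inv_mul_eq_div, Set.mem_Icc, le_div_iff₀ (by positivity), div_le_one (by positivity)]
    constructor <;> linarith
  · simp only [LinearMap.smul_apply, LinearMap.add_apply, smul_eq_mul, hu ξ hξ, hu η hη] at heq
    rw [map_sub, sub_eq_zero]
    exact add_right_cancel (mul_left_cancel₀ (by positivity) heq)

end StateSpace

theorem Real.sqrt_mul_sqrt_add_sqrt_mul_sqrt_lt_one {a b : ℝ} (ha : a ∈ Set.Icc (0 : ℝ) 1)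
    (hb : b ∈ Set.Icc (0 : ℝ) 1) (hab : a ≠ b) : √a * √b + √(1 - a) * √(1 - b) < 1 := by
  have h1 := Real.sq_sqrt ha.1
  have h2 := Real.sq_sqrt hb.1
  have h3 := Real.sq_sqrt (sub_nonneg.2 ha.2)
  have h4 := Real.sq_sqrt (sub_nonneg.2 hb.2)
  have hpos : 0 < (√a - √b) ^ 2 :=
    sq_pos_of_ne_zero (sub_ne_zero.2 fun h => hab (by rw [← h1, ← h2, h]))
  nlinarith [sq_nonneg (√(1 - a) - √(1 - b))]

section Tensor

variable {ι₁ ι₂ : Type}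

theorem etmul_tmul (e : (ι₁ → ℝ) →ₗ[ℝ] ℝ) (f : (ι₂ → ℝ) →ₗ[ℝ] ℝ) (ω : ι₁ → ℝ) (σ : ι₂ → ℝ) :
    etmul e f (tmul ω σ) = e ω * f σ := by
  have h : curryMap f (tmul ω σ) = f σ • ω := by
    funext i
    change f (ω i • σ) = f σ * ω i
    rw [map_smul, smul_eq_mul, mul_comm]
  rw [etmul, LinearMap.comp_apply, h, map_smul, smul_eq_mul, mul_comm]

theorem sum_etmul {X Y : Type*} [Fintype X] [Fintype Y] (e : X → ((ι₁ → ℝ) →ₗ[ℝ] ℝ))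
    (f : Y → ((ι₂ → ℝ) →ₗ[ℝ] ℝ)) (μ : ι₁ × ι₂ → ℝ) :
    ∑ p : X × Y, etmul (e p.1) (f p.2) μ = etmul (∑ x, e x) (∑ y, f y) μ := by
  have h : curryMap (∑ y, f y) μ = ∑ y, curryMap (f y) μ := by
    funext i
    simp [curryMap]
  simp [etmul, h, Fintype.sum_prod_type]

/-- Tensoring with a fixed second factor, as a linear map. -/
def tmulRight (σ : ι₂ → ℝ) : (ι₁ → ℝ) →ₗ[ℝ] (ι₁ × ι₂ → ℝ) where
  toFun ω := tmul ω σ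
  map_add' ω τ := by funext p; exact add_mul _ _ _
  map_smul' c ω := by funext p; exact mul_assoc _ _ _

variable [Fintype ι₁] [Fintype ι₂] {Ω₁ : Set (ι₁ → ℝ)} {Ω₂ : Set (ι₂ → ℝ)}
  {Ωtot : Set (ι₁ × ι₂ → ℝ)}

theorem IsComposite.tmul_mem (h : IsComposite Ω₁ Ω₂ Ωtot) {ω : ι₁ → ℝ} {σ : ι₂ → ℝ}
    (hω : ω ∈ Ω₁) (hσ : σ ∈ Ω₂) : tmul ω σ ∈ Ωtot :=
  h.2.2.1 (subset_convexHull ℝ _ ⟨ω, hω, σ, hσ, rfl⟩)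

theorem IsComposite.isObservable_etmul (h : IsComposite Ω₁ Ω₂ Ωtot) {X Y : Type*} [Fintype X]
    [Fintype Y] {e : X → ((ι₁ → ℝ) →ₗ[ℝ] ℝ)} {f : Y → ((ι₂ → ℝ) →ₗ[ℝ] ℝ)}
    (he : IsObservable Ω₁ e) (hf : IsObservable Ω₂ f) :
    IsObservable Ωtot fun p : X × Y => etmul (e p.1) (f p.2) := by
  have hsum (μ) (hμ : μ ∈ Ωtot) : ∑ p : X × Y, etmul (e p.1) (f p.2) μ = 1 := by
    rw [sum_etmul]
    exact (h.2.2.2 hμ).1 _ _ (fun ω hω => by simpa using he.2 ω hω)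
      (fun ω hω => by simpa using hf.2 ω hω)
  have hnn (μ) (hμ : μ ∈ Ωtot) (p : X × Y) : 0 ≤ etmul (e p.1) (f p.2) μ :=
    (h.2.2.2 hμ).2 _ _ (he.1 _) (hf.1 _)
  refine ⟨fun p μ hμ => ⟨hnn μ hμ p, ?_⟩, hsum⟩
  rw [← hsum μ hμ]
  exact Finset.single_le_sum (f := fun p : X × Y => etmul (e p.1) (f p.2) μ)
    (fun q _ => hnn μ hμ q) (Finset.mem_univ p)

/-- If a dynamics of the composite sends `ωᵢ ⊗ ξ` to `ωᵢ' ⊗ ξᵢ'`, then the fidelity of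
`ω₁, ω₂` is at most that of `ω₁', ω₂'` times the overlap of `ξ₁', ξ₂'` in any observable. -/
theorem IsComposite.fidelity_le_fidelity_mul (h : IsComposite Ω₁ Ω₂ Ωtot)
    (hΩ₁ : IsStateSpace Ω₁) {Λ : (ι₁ × ι₂ → ℝ) →ₗ[ℝ] (ι₁ × ι₂ → ℝ)}
    (hΛ : Set.MapsTo Λ Ωtot Ωtot) {ξ ξ₁' ξ₂' : ι₂ → ℝ} (hξ : ξ ∈ Ω₂) {ω₁ ω₂ ω₁' ω₂' : ι₁ → ℝ}
    (hω₁' : ω₁' ∈ Ω₁) (hω₂' : ω₂' ∈ Ω₁)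
    (h1 : Λ (tmul ω₁ ξ) = tmul ω₁' ξ₁') (h2 : Λ (tmul ω₂ ξ) = tmul ω₂' ξ₂')
    {Y : Type*} [Fintype Y] {f : Y → ((ι₂ → ℝ) →ₗ[ℝ] ℝ)} (hf : IsObservable Ω₂ f) :
    fidelity Ω₁ ω₁ ω₂ ≤ fidelity Ω₁ ω₁' ω₂' * ∑ y, √(f y ξ₁') * √(f y ξ₂') := by
  obtain ⟨u, hu⟩ := hΩ₁.exists_isUnitEffect_s6
  have key (nn : ℕ) (e : Fin nn → ((ι₁ → ℝ) →ₗ[ℝ] ℝ)) (he : IsObservable Ω₁ e) :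
      fidelity Ω₁ ω₁ ω₂ ≤
        (∑ x, √(e x ω₁') * √(e x ω₂')) * ∑ y, √(f y ξ₁') * √(f y ξ₂') := by
    rw [Fintype.sum_mul_sum, ← Fintype.sum_prod_type']
    have hmaps : Set.MapsTo (Λ.comp (tmulRight ξ)) Ω₁ Ωtot := fun ω hω => hΛ (h.tmul_mem hω hξ)
    refine (fidelity_le ω₁ ω₂ ((h.isObservable_etmul he hf).comp_mapsTo hmaps)).trans_eq
      (Finset.sum_congr rfl fun p _ => ?_)
    change √(etmul (e p.1) (f p.2) (Λ (tmul ω₁ ξ))) * √(etmul (e p.1) (f p.2) (Λ (tmul ω₂ ξ))) = _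
    rw [h1, h2, etmul_tmul, etmul_tmul, Real.sqrt_mul (he.1 _ _ hω₁').1,
      Real.sqrt_mul (he.1 _ _ hω₂').1, mul_mul_mul_comm]
  have hnn : 0 ≤ ∑ y, √(f y ξ₁') * √(f y ξ₂') := by positivity
  obtain hzero | hpos := hnn.eq_or_lt
  · have hu' : IsObservable Ω₁ fun _ : Fin 1 => u :=
      ⟨fun _ τ hτ => by simp [hu τ hτ], fun τ hτ => by simp [hu τ hτ]⟩
    simpa [← hzero] using key 1 _ hu'
  · rw [← div_le_iff₀ hpos]
    exact le_fidelity hu fun nn e he => (div_le_iff₀ hpos).2 (key nn e he)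

end Tensor

/-- Lemma 1: if a program `ξ` sends pure inputs `ω₁, ω₂` to `α ωᵢ ⊗ ξᵢ'` through a
reversible dynamics on a composite state space, and `ω₁, ω₂` are not perfectly
distinguishable, then the residual apparatus states coincide: `ξ₁' = ξ₂'`. -/
theorem residual_eq_of_not_distinguishable {ι₁ ι₂ : Type} [Fintype ι₁] [Fintype ι₂]
    (Ωsys : Set (ι₁ → ℝ)) (Ωapp : Set (ι₂ → ℝ)) (Ωtot : Set (ι₁ × ι₂ → ℝ))
    (hsys : IsStateSpace Ωsys) (happ : IsStateSpace Ωapp)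
    (htot : IsComposite Ωsys Ωapp Ωtot)
    (Λ : (ι₁ × ι₂ → ℝ) →ₗ[ℝ] (ι₁ × ι₂ → ℝ)) (hΛ : Set.BijOn Λ Ωtot Ωtot)
    (ξ : ι₂ → ℝ) (hξ : ξ ∈ Ωapp.extremePoints ℝ)
    (α : (ι₁ → ℝ) →ₗ[ℝ] (ι₁ → ℝ)) (hα : Set.BijOn α Ωsys Ωsys)
    (ω₁ ω₂ : ι₁ → ℝ) (hω₁ : ω₁ ∈ Ωsys.extremePoints ℝ) (hω₂ : ω₂ ∈ Ωsys.extremePoints ℝ)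
    (hne : ω₁ ≠ ω₂)
    (ξ₁' ξ₂' : ι₂ → ℝ) (hξ₁' : ξ₁' ∈ Ωapp.extremePoints ℝ) (hξ₂' : ξ₂' ∈ Ωapp.extremePoints ℝ)
    (h1 : Λ (tmul ω₁ ξ) = tmul (α ω₁) ξ₁')
    (h2 : Λ (tmul ω₂ ξ) = tmul (α ω₂) ξ₂')
    (hnd : ¬ ∃ e : (ι₁ → ℝ) →ₗ[ℝ] ℝ, IsEffect Ωsys e ∧ e ω₁ = 1 ∧ e ω₂ = 0) :
    ξ₁' = ξ₂' := by
  by_contra hξne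
  obtain ⟨u, hu⟩ := happ.exists_isUnitEffect_s6
  obtain ⟨f, hf, hfne⟩ := happ.exists_isEffect_ne_s6 hξ₁'.1 hξ₂'.1 hξne
  have hobs : IsObservable Ωapp ![f, u - f] := by
    refine ⟨fun x τ hτ => ?_, fun τ hτ => by simp [hu τ hτ]⟩
    have hτf := hf τ hτ
    fin_cases x
    · exact hτf
    · simpa [hu τ hτ, and_comm] using hτf
  have hlt := Real.sqrt_mul_sqrt_add_sqrt_mul_sqrt_lt_one (hf _ hξ₁'.1) (hf _ hξ₂'.1) hfne
  have hF := hsys.fidelity_pos hω₁.1 hω₂.1 hnd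
  have hle := htot.fidelity_le_fidelity_mul hsys hΛ.mapsTo hξ.1 (hα.mapsTo hω₁.1)
    (hα.mapsTo hω₂.1) h1 h2 hobs
  have hmono := hsys.fidelity_map_le hα ω₁ ω₂
  simp only [Fin.sum_univ_two, Matrix.cons_val_zero, Matrix.cons_val_one, LinearMap.sub_apply,
    hu _ hξ₁'.1, hu _ hξ₂'.1] at hle
  refine hle.not_gt (lt_of_le_of_lt (mul_le_mul_of_nonneg_right hmono (by positivity)) ?_)
  exact mul_lt_of_lt_one_right hF hlt
end

section
/- (Proposition 3, first part) Let Ω be a state space with dim span(Ω) = d < ∞. If there exists a quasi-classical decomposition Ω^ext = ⋃_{z∈Z} Ω^ext[z] of the set of pure states of Ω, then |Z| ≤ d. Moreover, any transversal {ω_z}_{z∈Z} with ω_z ∈ Ω^ext[z] for each z is a linearly independent family. -/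
open scoped BigOperators

/-- A quasi-classical decomposition of the pure states of `Ω`: a disjoint decomposition of
the set of extreme points into at least two nonempty classes `P z`, together with an
observable `{A_z}` with `A_z(ω) = δ_{z z'}` for every pure state `ω` in the class `P z'`. -/
def IsQCDecomp {V : Type*} [NormedAddCommGroup V] [NormedSpace ℝ V] (Ω : Set V)
    {Z : Type*} [Fintype Z] [DecidableEq Z] (P : Z → Set V) : Prop :=
  (∀ z, (P z).Nonempty) ∧ (Pairwise fun z z' => Disjoint (P z) (P z')) ∧
  (⋃ z, P z) = Ω.extremePoints ℝ ∧ 2 ≤ Fintype.card Z ∧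
  ∃ A : Z → (V →ₗ[ℝ] ℝ), IsObservable Ω A ∧
    ∀ z z' : Z, ∀ ω ∈ P z', A z ω = if z = z' then 1 else 0

/-- Proposition 3 (first part): a quasi-classical decomposition has at most
`d = dim span(Ω)` classes, and any transversal of the classes is linearly independent. -/
theorem qc_decomp_card_le {V : Type*} [NormedAddCommGroup V] [NormedSpace ℝ V]
    [FiniteDimensional ℝ V] (Ω : Set V) (hΩ : IsStateSpace Ω)
    (d : ℕ) (hd : Module.finrank ℝ V = d)
    {Z : Type*} [Fintype Z] [DecidableEq Z] (P : Z → Set V) (hqc : IsQCDecomp Ω P) :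
    Fintype.card Z ≤ d ∧
      ∀ ω : Z → V, (∀ z, ω z ∈ P z) → LinearIndependent ℝ ω := by
  obtain ⟨hne, -, -, -, A, -, hA⟩ := hqc
  have hli : ∀ ω : Z → V, (∀ z, ω z ∈ P z) → LinearIndependent ℝ ω := by
    intro ω hω
    rw [Fintype.linearIndependent_iff]
    intro g hg z
    simpa [hA z _ _ (hω _)] using congrArg (A z) hg
  refine ⟨?_, hli⟩
  choose ω hω using hne
  exact hd ▸ (hli ω hω).fintype_card_le_finrank
end

section
/- (Proposition 3, second part) Let Ω be a state space with dim span(Ω) = d < ∞ and let Ω^ext = ⋃_{z∈Z} Ω^ext[z] be a quasi-classical decomposition of the set of pure states of Ω. If |Z| = d, then every class Ω^ext[z] consists of exactly one state, Ω^ext is a set of d linearly independent points, and Ω is the convex hull of these d points (i.e., Ω is a simplex with d pure states). -/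
open scoped BigOperators

/-- If finitely many functionals `A` are biorthogonal to a family `ω`, then `ω` is linearly
independent. -/
theorem linearIndependent_of_biorthogonal {R M ι : Type*} [CommRing R] [AddCommGroup M]
    [Module R M] [Fintype ι] [DecidableEq ι] {ω : ι → M} {A : ι → (M →ₗ[R] R)}
    (h : ∀ i j, A i (ω j) = if i = j then 1 else 0) : LinearIndependent R ω := by
  rw [Fintype.linearIndependent_iff]
  intro g hg i
  simpa [h] using congrArg (A i) hg

/-- Functionals biorthogonal to a spanning family separate points. -/
theorem eq_of_biorthogonal_of_span_eq_top {R M ι : Type*} [CommRing R] [AddCommGroup M]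
    [Module R M] [Fintype ι] [DecidableEq ι] {ω : ι → M} {A : ι → (M →ₗ[R] R)}
    (h : ∀ i j, A i (ω j) = if i = j then 1 else 0)
    (hspan : Submodule.span R (Set.range ω) = ⊤) {x y : M} (hxy : ∀ i, A i x = A i y) :
    x = y := by
  have expand : ∀ v : M, ∑ i, A i v • ω i = v := by
    intro v
    obtain ⟨c, rfl⟩ := (Submodule.mem_span_range_iff_exists_fun R).1
      (hspan ▸ Submodule.mem_top : v ∈ Submodule.span R (Set.range ω))
    simp [h]
  rw [← expand x, ← expand y]
  simp only [hxy]

/-- Proposition 3 (second part): if a quasi-classical decomposition has exactly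
`d = dim span(Ω)` classes, then each class is a singleton, the pure states form a set of
`d` linearly independent points, and `Ω` is their convex hull (a simplex). -/
theorem qc_decomp_card_eq_simplex {V : Type*} [NormedAddCommGroup V] [NormedSpace ℝ V]
    [FiniteDimensional ℝ V] (Ω : Set V) (hΩ : IsStateSpace Ω)
    (d : ℕ) (hd : Module.finrank ℝ V = d)
    {Z : Type*} [Fintype Z] [DecidableEq Z] (P : Z → Set V) (hqc : IsQCDecomp Ω P)
    (hcard : Fintype.card Z = d) :
    ∃ ω : Z → V, (∀ z, P z = {ω z}) ∧ LinearIndependent ℝ ω ∧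
      Ω.extremePoints ℝ = Set.range ω ∧ Ω = convexHull ℝ (Set.range ω) := by
  obtain ⟨hcompact, hconvex, -, -⟩ := hΩ
  obtain ⟨hne, -, hunion, hcard_two, A, -, hA⟩ := hqc
  choose ω hω using hne
  have hbi : ∀ z z', A z (ω z') = if z = z' then 1 else 0 := fun z z' => hA z z' _ (hω z')
  have hli : LinearIndependent ℝ ω := linearIndependent_of_biorthogonal hbi
  have : Nonempty Z := Fintype.card_pos_iff.1 (by omega)
  have hspan : Submodule.span ℝ (Set.range ω) = ⊤ :=
    hli.span_eq_top_of_card_eq_finrank (hcard.trans hd.symm)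
  have hP : ∀ z, P z = {ω z} := fun z =>
    Set.eq_singleton_iff_unique_mem.2 ⟨hω z, fun x hx =>
      eq_of_biorthogonal_of_span_eq_top hbi hspan fun i => by rw [hA i z x hx, hbi]⟩
  have hext : Ω.extremePoints ℝ = Set.range ω := by
    rw [← hunion]
    simp only [hP, Set.iUnion_singleton_eq_range]
  refine ⟨ω, hP, hli, hext, ?_⟩
  rw [← (Set.finite_range ω).isClosed_convexHull ℝ |>.closure_eq, ← hext]
  exact (closure_convexHull_extremePoints hcompact hconvex).symm
end

section
/- (Proposition 4) Let Ω be a state space, Ω^ext its set of pure states, and Ω^ext = ⋃_{z∈Z} Ω^ext[z] a disjoint decomposition into finitely many (at least two) nonempty classes; write Ω[z] for the convex hull of Ω^ext[z]. Then the decomposition is quasi-classical if and only if it satisfies the following condition (⋆): whenever a state ω ∈ Ω is expressed as ω = Σ_{z∈Z} p_z ω_z = Σ_{z∈Z} q_z ω'_z with ω_z, ω'_z ∈ Ω[z] and {p_z}, {q_z} probability distributions on Z, one has p_z = q_z for all z ∈ Z. -/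
open scoped BigOperators

/-- A compact convex set lies in every closed convex set that contains its extreme points. -/
lemma subset_of_extremePoints_subset {V : Type*} [NormedAddCommGroup V] [NormedSpace ℝ V]
    {Ω C : Set V} (hcomp : IsCompact Ω) (hconv : Convex ℝ Ω) (hC : IsClosed C)
    (hCconv : Convex ℝ C) (h : Ω.extremePoints ℝ ⊆ C) : Ω ⊆ C := by
  rw [← closure_convexHull_extremePoints hcomp hconv]
  exact closure_minimal (convexHull_min h hCconv) hC

/-- A nonnegative combination of points of a nonempty set is its total weight times a point of
the convex hull. -/
lemma exists_mem_convexHull_sum_smul_eq {V ι : Type*} [AddCommGroup V] [Module ℝ V]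
    {S : Set V} (hS : S.Nonempty) (s : Finset ι) (w : ι → ℝ) (x : ι → V)
    (hw : ∀ i ∈ s, 0 ≤ w i) (hx : ∀ i ∈ s, x i ∈ S) :
    ∃ y ∈ convexHull ℝ S, ∑ i ∈ s, w i • x i = (∑ i ∈ s, w i) • y := by
  rcases (Finset.sum_nonneg hw).eq_or_lt with h | h
  · obtain ⟨y, hy⟩ := hS
    refine ⟨y, subset_convexHull ℝ S hy, ?_⟩
    rw [← h, zero_smul]
    refine Finset.sum_eq_zero fun i hi => ?_
    rw [(Finset.sum_eq_zero_iff_of_nonneg hw).1 h.symm i hi, zero_smul]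
  · refine ⟨s.centerMass w x, s.centerMass_mem_convexHull hw h hx, ?_⟩
    rw [Finset.centerMass, smul_inv_smul₀ h.ne']

/-- If the affine span of `S` misses the origin, then the coefficients of every linear relation
between points of `S` add up to zero. -/
lemma sum_eq_zero_of_sum_smul_eq_zero {V ι : Type*} [AddCommGroup V] [Module ℝ V]
    {S : Set V} (hS : (0 : V) ∉ (affineSpan ℝ S : Set V)) (s : Finset ι) (w : ι → ℝ)
    (x : ι → V) (hx : ∀ i, x i ∈ S) (h : ∑ i ∈ s, w i • x i = 0) : ∑ i ∈ s, w i = 0 := by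
  by_contra hne
  have h1 : ∑ i ∈ s, (∑ j ∈ s, w j)⁻¹ * w i = 1 := by
    rw [← Finset.mul_sum, inv_mul_cancel₀ hne]
  have h2 := affineCombination_mem_affineSpan h1 x
  rw [Finset.affineCombination_eq_linear_combination _ _ _ h1] at h2
  simp only [mul_smul, ← Finset.smul_sum, h, smul_zero] at h2
  exact hS (affineSpan_mono ℝ (Set.range_subset_iff.2 hx) h2)

/-- A linear map vanishing on the kernel of a surjective linear map factors through it. -/
lemma exists_linearMap_comp_eq {K M N L : Type*} [Field K] [AddCommGroup M] [Module K M]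
    [AddCommGroup N] [Module K N] [AddCommGroup L] [Module K L] (T : M →ₗ[K] N)
    (hT : Function.Surjective T) (B : M →ₗ[K] L) (h : ∀ c, T c = 0 → B c = 0) :
    ∃ A : N →ₗ[K] L, ∀ c, A (T c) = B c := by
  obtain ⟨g, hg⟩ := T.exists_rightInverse_of_surjective (LinearMap.range_eq_top.2 hT)
  refine ⟨B ∘ₗ g, fun c => ?_⟩
  rw [LinearMap.comp_apply, ← sub_eq_zero, ← map_sub]
  refine h _ ?_
  rw [map_sub, sub_eq_zero]
  exact LinearMap.congr_fun hg (T c)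

/-- If class-wise mixture decompositions are unique, then the coefficients of a linear relation
between points of the classes add up to zero on each class. -/
lemma sum_filter_eq_zero_of_unique_decomposition {V Z ι : Type*} [AddCommGroup V] [Module ℝ V]
    [Fintype Z] [DecidableEq Z] {Ω : Set V} (hconv : Convex ℝ Ω)
    (h0 : (0 : V) ∉ (affineSpan ℝ Ω : Set V)) {P : Z → Set V} (hne : ∀ z, (P z).Nonempty)
    (hP : ∀ z, P z ⊆ Ω)
    (huniq : ∀ (p q : Z → ℝ) (ωp ωq : Z → V),
      (∀ z, 0 ≤ p z) → ∑ z, p z = 1 → (∀ z, 0 ≤ q z) → ∑ z, q z = 1 →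
      (∀ z, ωp z ∈ convexHull ℝ (P z)) → (∀ z, ωq z ∈ convexHull ℝ (P z)) →
      ∑ z, p z • ωp z ∈ Ω →
      ∑ z, p z • ωp z = ∑ z, q z • ωq z → ∀ z, p z = q z)
    (s : Finset ι) (k : ι → Z) (x : ι → V) (hx : ∀ i, x i ∈ P (k i)) (c : ι → ℝ)
    (hc : ∑ i ∈ s, c i • x i = 0) (z : Z) : ∑ i ∈ s with k i = z, c i = 0 := by
  have hsum := sum_eq_zero_of_sum_smul_eq_zero h0 s c x (fun i => hP _ (hx i)) hc
  have hsplit (i : ι) : c i = (c i)⁺ - (c i)⁻ := (posPart_sub_negPart (c i)).symm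
  have hN : ∑ i ∈ s, (c i)⁺ = ∑ i ∈ s, (c i)⁻ := by
    rw [← sub_eq_zero, ← Finset.sum_sub_distrib]
    simpa only [posPart_sub_negPart] using hsum
  have hv : ∑ i ∈ s, (c i)⁺ • x i = ∑ i ∈ s, (c i)⁻ • x i := by
    rw [← sub_eq_zero, ← Finset.sum_sub_distrib]
    simpa only [← sub_smul, posPart_sub_negPart] using hc
  rcases (Finset.sum_nonneg fun i _ => posPart_nonneg (c i) :
    0 ≤ ∑ i ∈ s, (c i)⁺).eq_or_lt with h | h
  · have hpos := (Finset.sum_eq_zero_iff_of_nonneg fun i _ => posPart_nonneg (c i)).1 h.symm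
    have hneg := (Finset.sum_eq_zero_iff_of_nonneg fun i _ => negPart_nonneg (c i)).1
      (hN.symm.trans h.symm)
    refine Finset.sum_eq_zero fun i hi => ?_
    have hi := (Finset.mem_filter.1 hi).1
    rw [hsplit, hpos i hi, hneg i hi, sub_zero]
  · set N := ∑ i ∈ s, (c i)⁺
    have hmem (w : ι → ℝ) (hw : ∀ i, 0 ≤ w i) (z : Z) :=
      exists_mem_convexHull_sum_smul_eq (hne z) {i ∈ s | k i = z} w x (fun i _ => hw i)
        (fun i hi => (Finset.mem_filter.1 hi).2 ▸ hx i)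
    choose y hy hy' using hmem _ fun i => posPart_nonneg (c i)
    choose y' hy₂ hy₂' using hmem _ fun i => negPart_nonneg (c i)
    have hp : ∀ z, 0 ≤ N⁻¹ * ∑ i ∈ s with k i = z, (c i)⁺ := fun z =>
      mul_nonneg (inv_nonneg.2 h.le) (Finset.sum_nonneg fun i _ => posPart_nonneg _)
    have hq : ∀ z, 0 ≤ N⁻¹ * ∑ i ∈ s with k i = z, (c i)⁻ := fun z =>
      mul_nonneg (inv_nonneg.2 h.le) (Finset.sum_nonneg fun i _ => negPart_nonneg _)
    have hp1 : ∑ z, N⁻¹ * ∑ i ∈ s with k i = z, (c i)⁺ = 1 := by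
      rw [← Finset.mul_sum, Finset.sum_fiberwise, inv_mul_cancel₀ h.ne']
    have hq1 : ∑ z, N⁻¹ * ∑ i ∈ s with k i = z, (c i)⁻ = 1 := by
      rw [← Finset.mul_sum, Finset.sum_fiberwise, ← hN, inv_mul_cancel₀ h.ne']
    have key := huniq _ _ y y' hp hp1 hq hq1 hy hy₂
      (hconv.sum_mem (fun z _ => hp z) hp1 fun z _ => convexHull_min (hP z) hconv (hy z))
      (by simp only [mul_smul, ← hy', ← hy₂', ← Finset.smul_sum, Finset.sum_fiberwise, hv]) z
    rw [Finset.sum_congr rfl fun i _ => hsplit i, Finset.sum_sub_distrib, sub_eq_zero]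
    exact mul_left_cancel₀ (inv_ne_zero h.ne') key

/-- Proposition 4: a disjoint decomposition of the pure states into finitely many (at
least two) nonempty classes is quasi-classical iff every state has a unique class-wise
mixture decomposition (condition (⋆)). -/
theorem qc_iff_unique_decomposition {V : Type*} [NormedAddCommGroup V] [NormedSpace ℝ V]
    [FiniteDimensional ℝ V] (Ω : Set V) (hΩ : IsStateSpace Ω)
    {Z : Type*} [Fintype Z] [DecidableEq Z] (hZ : 2 ≤ Fintype.card Z) (P : Z → Set V)
    (hne : ∀ z, (P z).Nonempty) (hdisj : Pairwise fun z z' => Disjoint (P z) (P z'))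
    (hcover : (⋃ z, P z) = Ω.extremePoints ℝ) :
    (∃ A : Z → (V →ₗ[ℝ] ℝ), IsObservable Ω A ∧
        ∀ z z' : Z, ∀ ω ∈ P z', A z ω = if z = z' then 1 else 0) ↔
      (∀ (p q : Z → ℝ) (ωp ωq : Z → V),
        (∀ z, 0 ≤ p z) → ∑ z, p z = 1 → (∀ z, 0 ≤ q z) → ∑ z, q z = 1 →
        (∀ z, ωp z ∈ convexHull ℝ (P z)) → (∀ z, ωq z ∈ convexHull ℝ (P z)) →
        ∑ z, p z • ωp z ∈ Ω →
        ∑ z, p z • ωp z = ∑ z, q z • ωq z → ∀ z, p z = q z) := by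
  obtain ⟨hcomp, hconv, hspan, h0⟩ := hΩ
  have hPext (z : Z) : P z ⊆ Ω.extremePoints ℝ := hcover ▸ Set.subset_iUnion P z
  have hP (z : Z) : P z ⊆ Ω := (hPext z).trans extremePoints_subset
  constructor
  · rintro ⟨A, -, hA⟩ p q ωp ωq - - - - hωp hωq - heq z
    have hval {z' : Z} {ω : V} (hω : ω ∈ convexHull ℝ (P z')) :
        A z ω = if z = z' then 1 else 0 :=
      convexHull_min (t := A z ⁻¹' {if z = z' then 1 else 0}) (fun ω hω => hA z z' ω hω)
        ((convex_singleton _).linear_preimage (A z)) hω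
    simpa [map_sum, hval (hωp _), hval (hωq _)] using congrArg (A z) heq
  · intro huniq
    let T : ((Σ z, P z) →₀ ℝ) →ₗ[ℝ] V := Finsupp.linearCombination ℝ fun i => (i.2 : V)
    let B (z : Z) : ((Σ z, P z) →₀ ℝ) →ₗ[ℝ] ℝ :=
      Finsupp.linearCombination ℝ fun i => if z = i.1 then 1 else 0
    have hT : Function.Surjective T := by
      rw [← LinearMap.range_eq_top, Finsupp.range_linearCombination, eq_top_iff, ← hspan,
        Submodule.span_le]
      refine subset_of_extremePoints_subset hcomp hconv (Submodule.closed_of_finiteDimensional _)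
        (Submodule.convex _) ?_
      rw [← hcover]
      refine Set.iUnion_subset fun z ω hω => Submodule.subset_span ⟨⟨z, ω, hω⟩, rfl⟩
    have hker (z : Z) (c : (Σ z, P z) →₀ ℝ) (hc : T c = 0) : B z c = 0 := by
      rw [Finsupp.linearCombination_apply, Finsupp.sum] at hc ⊢
      have := sum_filter_eq_zero_of_unique_decomposition hconv h0 hne hP huniq c.support
        Sigma.fst _ (fun i => i.2.2) c hc z
      simpa [Finset.sum_filter, eq_comm] using this
    choose A hA using fun z => exists_linearMap_comp_eq T hT (B z) (hker z)
    have hval (z z' : Z) (ω : V) (hω : ω ∈ P z') : A z ω = if z = z' then 1 else 0 := by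
      simpa [T, B] using hA z (Finsupp.single ⟨z', ω, hω⟩ 1)
    have hnonneg (z : Z) : Ω ⊆ A z ⁻¹' Set.Ici 0 := by
      refine subset_of_extremePoints_subset hcomp hconv
        (isClosed_Ici.preimage (A z).continuous_of_finiteDimensional)
        ((convex_Ici 0).linear_preimage _) ?_
      rw [← hcover]
      refine Set.iUnion_subset fun z' ω hω => ?_
      rw [Set.mem_preimage, hval z z' ω hω, Set.mem_Ici]
      split_ifs <;> norm_num
    have hsum : Ω ⊆ ⇑(∑ z, A z : V →ₗ[ℝ] ℝ) ⁻¹' {1} := by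
      refine subset_of_extremePoints_subset hcomp hconv
        (isClosed_singleton.preimage (∑ z, A z : V →ₗ[ℝ] ℝ).continuous_of_finiteDimensional)
        ((convex_singleton 1).linear_preimage _) ?_
      rw [← hcover]
      refine Set.iUnion_subset fun z' ω hω => ?_
      simp [hval _ z' ω hω]
    have hsum' (ω : V) (hω : ω ∈ Ω) : ∑ z, A z ω = 1 := by
      simpa [LinearMap.sum_apply] using hsum hω
    refine ⟨A, ⟨fun z ω hω => ⟨hnonneg z hω, ?_⟩, hsum'⟩, hval⟩
    rw [← hsum' ω hω]
    exact Finset.single_le_sum (f := fun z => A z ω) (fun z _ => hnonneg z hω) (Finset.mem_univ z)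
end

section
/- Let M ≥ 3, r_M := (cos(π/M))^{−1/2}, and for i = 1, …, M let ω_i := (r_M² cos(2πi/M), r_M² sin(2πi/M), 1) ∈ ℝ³, the pure states of the regular polygon state space Ω_M := conv{ω_1, …, ω_M}. Call a finite family A_1, …, A_M ∈ ℝ³ an M-outcome observable on Ω_M if ⟨A_i, ω⟩ ≥ 0 for every ω ∈ Ω_M and every i, and Σ_{i=1}^M A_i = (0,0,1) (the unit effect), where ⟨·,·⟩ is the Euclidean inner product. Then the maximum over all M-outcome observables of the average success probability (1/M) Σ_{i=1}^M ⟨A_i, ω_i⟩ equals 2/M if M is even and (1 + r_M²)/M if M is odd. -/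
open scoped BigOperators

/-- `r_M = (cos(π/M))^{-1/2}`. -/
noncomputable def rM (M : ℕ) : ℝ := (Real.sqrt (Real.cos (Real.pi / M)))⁻¹

/-- The `i`-th pure state of the regular polygon theory with `M` sides. -/
noncomputable def polyState (M : ℕ) (i : ℕ) : Fin 3 → ℝ :=
  ![rM M ^ 2 * Real.cos (2 * Real.pi * i / M),
    rM M ^ 2 * Real.sin (2 * Real.pi * i / M), 1]

/-- The state space of the regular polygon theory with `M` sides: the convex hull of the
pure states `ω_1, …, ω_M`. -/
noncomputable def polyΩ (M : ℕ) : Set (Fin 3 → ℝ) :=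
  convexHull ℝ {w | ∃ i : Fin M, w = polyState M (i.1 + 1)}

/-- The Euclidean inner product on `ℝ³`. -/
def dot (A w : Fin 3 → ℝ) : ℝ := ∑ k, A k * w k

theorem cos_pi_div_nat_pos {M : ℕ} (hM : 3 ≤ M) : 0 < Real.cos (Real.pi / M) := by
  have hM' : (3 : ℝ) ≤ M := by exact_mod_cast hM
  have hpi := Real.pi_pos
  apply Real.cos_pos_of_mem_Ioo
  constructor
  · have : 0 < Real.pi / M := by positivity
    linarith
  · rw [div_lt_div_iff₀ (by linarith) (by norm_num)]
    nlinarith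

theorem rM_sq {M : ℕ} (hM : 3 ≤ M) : rM M ^ 2 = (Real.cos (Real.pi / M))⁻¹ := by
  rw [rM, inv_pow, Real.sq_sqrt (cos_pi_div_nat_pos hM).le]

theorem dot_vec (a b c x y z : ℝ) : dot ![a, b, c] ![x, y, z] = a * x + b * y + c * z := by
  simp [dot, Fin.sum_univ_three]

theorem convex_setOf_dot_nonneg (A : Fin 3 → ℝ) : Convex ℝ {w | 0 ≤ dot A w} := by
  intro x hx y hy a b ha hb _
  have h : dot A (a • x + b • y) = a * dot A x + b * dot A y := by
    simp only [dot, Fin.sum_univ_three, Pi.add_apply, Pi.smul_apply, smul_eq_mul]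
    ring
  simp only [Set.mem_ofPred_eq] at hx hy ⊢
  rw [h]
  positivity

theorem polyState_periodic {M : ℕ} (hM : 0 < M) : Function.Periodic (polyState M) M := by
  intro n
  have hM' : (M : ℝ) ≠ 0 := by positivity
  have h : 2 * Real.pi * ((n + M : ℕ) : ℝ) / M = 2 * Real.pi * n / M + 2 * Real.pi := by
    push_cast
    field_simp
  simp only [polyState, h, Real.cos_add_two_pi, Real.sin_add_two_pi]

theorem polyState_mem {M : ℕ} (hM : 0 < M) (n : ℕ) : polyState M n ∈ polyΩ M := by
  apply subset_convexHull
  refine ⟨⟨(n + M - 1) % M, Nat.mod_lt _ hM⟩, ?_⟩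
  have hp : Function.Periodic (fun k => polyState M (k + 1)) M := fun k => by
    simpa [add_right_comm] using polyState_periodic hM (k + 1)
  have h := hp.map_mod_nat (n + M - 1)
  rw [h, Nat.sub_add_cancel (by omega), polyState_periodic hM n]

theorem midpoint_polyState_mem {M : ℕ} (hM : 0 < M) (m n : ℕ) :
    (1 / 2 : ℝ) • polyState M m + (1 / 2 : ℝ) • polyState M n ∈ polyΩ M :=
  convex_convexHull ℝ _ (polyState_mem hM m) (polyState_mem hM n)
    (by norm_num) (by norm_num) (by norm_num)

theorem sum_exp_polygon {M : ℕ} (hM : 1 < M) :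
    ∑ i : Fin M, Complex.exp ((2 * Real.pi * ((i.1 + 1 : ℕ) : ℝ) / M : ℝ) * Complex.I) = 0 := by
  have hζ := Complex.isPrimitiveRoot_exp M (by omega)
  have h := hζ.geom_sum_eq_zero hM
  have key : ∀ k : ℕ, Complex.exp ((2 * Real.pi * ((k + 1 : ℕ) : ℝ) / M : ℝ) * Complex.I)
      = Complex.exp (2 * Real.pi * Complex.I / M) *
        Complex.exp (2 * Real.pi * Complex.I / M) ^ k := by
    intro k
    rw [← pow_succ', ← Complex.exp_nat_mul]
    congr 1
    push_cast
    ring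
  simp only [key]
  rw [Fin.sum_univ_eq_sum_range
    (fun k => Complex.exp (2 * Real.pi * Complex.I / M) *
      Complex.exp (2 * Real.pi * Complex.I / M) ^ k), ← Finset.mul_sum, h, mul_zero]

theorem sum_cos_polygon {M : ℕ} (hM : 1 < M) :
    ∑ i : Fin M, Real.cos (2 * Real.pi * ((i.1 + 1 : ℕ) : ℝ) / M) = 0 := by
  have h := congrArg Complex.re (sum_exp_polygon hM)
  simpa only [Complex.re_sum, Complex.exp_ofReal_mul_I_re, Complex.zero_re] using h

theorem sum_sin_polygon {M : ℕ} (hM : 1 < M) :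
    ∑ i : Fin M, Real.sin (2 * Real.pi * ((i.1 + 1 : ℕ) : ℝ) / M) = 0 := by
  have h := congrArg Complex.im (sum_exp_polygon hM)
  simpa only [Complex.im_sum, Complex.exp_ofReal_mul_I_im, Complex.zero_im] using h

/-- The maximal success probability, given `s > 0` such that the effects `(s cos θ, s sin θ, 1)`
in the vertex directions are nonnegative on the polygon and the points `-(cos θ, sin θ) / s`
opposite to the vertices belong to the polygon. -/
theorem isGreatest_success {M : ℕ} (hM : 1 < M) {s : ℝ} (hs : 0 < s)
    (heff : ∀ i j : ℕ, i ≤ M → j ≤ M → 0 ≤ s * rM M ^ 2 *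
      Real.cos (2 * Real.pi * i / M - 2 * Real.pi * j / M) + 1)
    (hopp : ∀ i : ℕ, ![-(Real.cos (2 * Real.pi * i / M) / s),
      -(Real.sin (2 * Real.pi * i / M) / s), 1] ∈ polyΩ M) :
    IsGreatest
      { r : ℝ | ∃ A : Fin M → (Fin 3 → ℝ),
          (∀ i, ∀ w ∈ polyΩ M, 0 ≤ dot (A i) w) ∧
          (∑ i, A i) = ![0, 0, 1] ∧
          r = (1 / (M : ℝ)) * ∑ i : Fin M, dot (A i) (polyState M (i.1 + 1)) }
      ((1 + s * rM M ^ 2) / M) := by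
  have hM0 : (0 : ℝ) < M := by
    have : 0 < M := by omega
    exact_mod_cast this
  have hdot : ∀ i j : ℕ, dot ![s * Real.cos (2 * Real.pi * i / M) / M,
      s * Real.sin (2 * Real.pi * i / M) / M, 1 / M] (polyState M j) =
      (s * rM M ^ 2 * Real.cos (2 * Real.pi * i / M - 2 * Real.pi * j / M) + 1) / M := by
    intro i j
    rw [polyState, dot_vec, Real.cos_sub]
    ring
  constructor
  · refine ⟨fun i => ![s * Real.cos (2 * Real.pi * ((i.1 + 1 : ℕ) : ℝ) / M) / M,
      s * Real.sin (2 * Real.pi * ((i.1 + 1 : ℕ) : ℝ) / M) / M, 1 / M], ?_, ?_, ?_⟩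
    · intro i w hw
      refine convexHull_min ?_ (convex_setOf_dot_nonneg _) hw
      rintro _ ⟨j, rfl⟩
      simp only [Set.mem_ofPred_eq]
      rw [hdot]
      exact div_nonneg (heff _ _ i.2 j.2) hM0.le
    · ext k
      rw [Finset.sum_apply]
      fin_cases k
      · simp only [Fin.zero_eta, Matrix.cons_val_zero]
        rw [← Finset.sum_div, ← Finset.mul_sum, sum_cos_polygon hM]
        simp
      · simp only [Fin.mk_one, Matrix.cons_val_one, Matrix.cons_val_zero]
        rw [← Finset.sum_div, ← Finset.mul_sum, sum_sin_polygon hM]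
        simp
      · simp [hM0.ne']
    · simp only [hdot, sub_self, Real.cos_zero]
      simp only [Finset.sum_const, Finset.card_univ, Fintype.card_fin, nsmul_eq_mul]
      field_simp
      ring
  · rintro _ ⟨A, hA, hsum, rfl⟩
    have hc : ∑ i, A i 2 = 1 := by
      have := congrFun hsum 2
      simpa [Finset.sum_apply] using this
    have hle : ∀ i : Fin M, dot (A i) (polyState M (i.1 + 1)) ≤ (1 + s * rM M ^ 2) * A i 2 := by
      intro i
      have h := hA i _ (hopp (i.1 + 1))
      have h' := mul_nonneg (mul_nonneg hs.le (sq_nonneg (rM M))) h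
      simp only [dot, polyState, Fin.sum_univ_three, Matrix.cons_val_zero, Matrix.cons_val_one,
        Matrix.cons_val] at h' ⊢
      have e : s * rM M ^ 2 *
          (A i 0 * -(Real.cos (2 * Real.pi * ((i.1 + 1 : ℕ) : ℝ) / M) / s) +
            A i 1 * -(Real.sin (2 * Real.pi * ((i.1 + 1 : ℕ) : ℝ) / M) / s) + A i 2 * 1) =
          s * rM M ^ 2 * A i 2 -
            (A i 0 * (rM M ^ 2 * Real.cos (2 * Real.pi * ((i.1 + 1 : ℕ) : ℝ) / M)) +
            A i 1 * (rM M ^ 2 * Real.sin (2 * Real.pi * ((i.1 + 1 : ℕ) : ℝ) / M))) := by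
        field_simp
        ring
      linarith
    have h := Finset.sum_le_sum fun i (_ : i ∈ Finset.univ) => hle i
    rw [← Finset.mul_sum, hc, mul_one] at h
    rw [one_div_mul_eq_div]
    gcongr

/-- For odd `M` no two vertices of the regular `M`-gon are closer to antipodal than the angle
`π / M`. -/
theorem neg_cos_pi_div_le_cos {M k : ℕ} (hodd : Odd M) (hk : k ≤ M) :
    -Real.cos (Real.pi / M) ≤ Real.cos (2 * Real.pi * k / M) := by
  have hM0 : (0 : ℝ) < M := by exact_mod_cast hodd.pos
  have hne : (2 * k : ℤ) - M ≠ 0 := by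
    obtain ⟨m, rfl⟩ := hodd
    omega
  have h1 : (1 : ℝ) ≤ |2 * (k : ℝ) - M| := by exact_mod_cast Int.one_le_abs hne
  have h2 : |2 * (k : ℝ) - M| ≤ M := by
    have : (k : ℝ) ≤ M := by exact_mod_cast hk
    rw [abs_le]
    constructor <;> linarith [(Nat.cast_nonneg k : (0 : ℝ) ≤ k)]
  have e : Real.cos (2 * Real.pi * k / M) = -Real.cos (Real.pi * |2 * (k : ℝ) - M| / M) := by
    have : Real.pi * |2 * (k : ℝ) - M| / M = |2 * Real.pi * k / M - Real.pi| := by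
      rw [show 2 * Real.pi * k / M - Real.pi = Real.pi * (2 * (k : ℝ) - M) / M by field_simp,
        abs_div, abs_mul, abs_of_pos Real.pi_pos, abs_of_pos hM0]
    rw [this, Real.cos_abs, Real.cos_sub_pi, neg_neg]
  rw [e, neg_le_neg_iff]
  apply Real.cos_le_cos_of_nonneg_of_le_pi
  · positivity
  · rw [div_le_iff₀ hM0]
    exact mul_le_mul_of_nonneg_left h2 Real.pi_pos.le
  · gcongr
    exact le_mul_of_one_le_right Real.pi_pos.le h1

theorem neg_cos_pi_div_le_cos_sub {M i j : ℕ} (hodd : Odd M) (hi : i ≤ M) (hj : j ≤ M) :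
    -Real.cos (Real.pi / M) ≤ Real.cos (2 * Real.pi * i / M - 2 * Real.pi * j / M) := by
  wlog h : j ≤ i generalizing i j
  · rw [← Real.cos_neg (_ - _), neg_sub]
    exact this hj hi (by omega)
  rw [← sub_div, ← mul_sub, ← Nat.cast_sub h]
  exact neg_cos_pi_div_le_cos hodd (by omega)

theorem opposite_mem_of_even {M : ℕ} (hM : 3 ≤ M) (heven : Even M) (i : ℕ) :
    ![-(Real.cos (2 * Real.pi * i / M) / Real.cos (Real.pi / M)),
      -(Real.sin (2 * Real.pi * i / M) / Real.cos (Real.pi / M)), 1] ∈ polyΩ M := by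
  obtain ⟨m, rfl⟩ := heven
  have hm : (m : ℝ) ≠ 0 := by
    have : m ≠ 0 := by omega
    exact_mod_cast this
  have h : 2 * Real.pi * ((i + m : ℕ) : ℝ) / ((m + m : ℕ) : ℝ) =
      2 * Real.pi * i / ((m + m : ℕ) : ℝ) + Real.pi := by
    push_cast
    field_simp
    ring
  convert polyState_mem (M := m + m) (by omega) (i + m) using 1
  rw [polyState, rM_sq hM, h, Real.cos_add_pi, Real.sin_add_pi]
  congr 1
  · ring
  · congr 1
    ring

theorem opposite_mem_of_odd {M : ℕ} (hM : 3 ≤ M) (hodd : Odd M) (i : ℕ) :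
    ![-(Real.cos (2 * Real.pi * i / M) / 1),
      -(Real.sin (2 * Real.pi * i / M) / 1), 1] ∈ polyΩ M := by
  have hc := cos_pi_div_nat_pos hM
  have hM0 : (M : ℝ) ≠ 0 := by
    have : M ≠ 0 := by omega
    exact_mod_cast this
  obtain ⟨m, hm⟩ := hodd
  have hm' : (M : ℝ) = 2 * m + 1 := by exact_mod_cast hm
  have h1 : 2 * Real.pi * ((i + m : ℕ) : ℝ) / M =
      2 * Real.pi * i / M - Real.pi / M + Real.pi := by
    push_cast
    field_simp
    rw [hm']
    ring
  have h2 : 2 * Real.pi * ((i + m + 1 : ℕ) : ℝ) / M =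
      2 * Real.pi * i / M + Real.pi / M + Real.pi := by
    push_cast
    field_simp
    rw [hm']
    ring
  convert midpoint_polyState_mem (M := M) (by omega) (i + m) (i + m + 1) using 1
  rw [polyState, polyState, rM_sq hM, h1, h2]
  simp only [Real.cos_add, Real.sin_add, Real.cos_sub,
    Real.sin_sub]
  ext k
  fin_cases k
  · simp
    field_simp
    ring
  · simp
    field_simp
    ring
  · simp
    norm_num

/-- The maximal average success probability `(1/M) Σᵢ ⟨Aᵢ, ωᵢ⟩` over all `M`-outcome
observables on the regular polygon state space equals `2/M` for even `M` and
`(1 + r_M²)/M` for odd `M`. -/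
theorem polygon_max_success (M : ℕ) (hM : 3 ≤ M) :
    IsGreatest
      { r : ℝ | ∃ A : Fin M → (Fin 3 → ℝ),
          (∀ i, ∀ w ∈ polyΩ M, 0 ≤ dot (A i) w) ∧
          (∑ i, A i) = ![0, 0, 1] ∧
          r = (1 / (M : ℝ)) * ∑ i : Fin M, dot (A i) (polyState M (i.1 + 1)) }
      (if Even M then 2 / (M : ℝ) else (1 + rM M ^ 2) / (M : ℝ)) := by
  have hc := cos_pi_div_nat_pos hM
  split_ifs with h
  · have e : 2 / (M : ℝ) = (1 + Real.cos (Real.pi / M) * rM M ^ 2) / M := by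
      rw [rM_sq hM, mul_inv_cancel₀ hc.ne']
      norm_num
    rw [e]
    refine isGreatest_success (by omega) hc (fun i j _ _ => ?_) (opposite_mem_of_even hM h)
    rw [rM_sq hM, mul_inv_cancel₀ hc.ne', one_mul]
    linarith [Real.neg_one_le_cos (2 * Real.pi * i / M - 2 * Real.pi * j / M)]
  · rw [Nat.not_even_iff_odd] at h
    rw [← one_mul (rM M ^ 2)]
    refine isGreatest_success (by omega) one_pos (fun i j hi hj => ?_) (opposite_mem_of_odd hM h)
    rw [one_mul, rM_sq hM, ← inv_mul_cancel₀ hc.ne', ← mul_add]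
    exact mul_nonneg (inv_nonneg.2 hc.le) (by linarith [neg_cos_pi_div_le_cos_sub h hi hj])
end

section
/- (Proposition A.1) Let Ω be a state space in V = span(Ω) with dim V = d < ∞, and let C ⊆ Ω be a family of states that is pairwise distinguishable, i.e., for any two distinct ω, σ ∈ C there exists an effect e with e(ω) = 1 and e(σ) = 0. Then C is a finite set. -/
open scoped BigOperators

/-- Effects on a spanning set are equicontinuous at `0`. -/
theorem exists_pos_forall_isEffect_lt_one {V : Type*} [NormedAddCommGroup V] [NormedSpace ℝ V]
    [FiniteDimensional ℝ V] {Ω : Set V} (hΩ : Submodule.span ℝ Ω = ⊤) :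
    ∃ δ > 0, ∀ e : V →ₗ[ℝ] ℝ, IsEffect Ω e → ∀ v : V, ‖v‖ < δ → e v < 1 := by
  obtain ⟨s, hs, hspan, hli⟩ := exists_linearIndependent ℝ Ω
  let b : Module.Basis s ℝ V := Module.Basis.mk hli (by simp [hspan, hΩ])
  have : Fintype s := FiniteDimensional.fintypeBasisIndex b
  have hcont : Continuous fun v : V => ∑ i, |b.coord i v| :=
    continuous_finsetSum _ fun i _ => (b.coord i).continuous_of_finiteDimensional.abs
  obtain ⟨δ, hδ, h⟩ := Metric.continuousAt_iff.1 (hcont.continuousAt (x := 0)) 1 one_pos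
  refine ⟨δ, hδ, fun e he v hv => ?_⟩
  have hlt := h (x := v) (by simpa using hv)
  simp only [map_zero, abs_zero, Finset.sum_const_zero, dist_zero_right, Real.norm_eq_abs] at hlt
  refine lt_of_le_of_lt ?_ ((le_abs_self _).trans_lt hlt)
  conv_lhs => rw [← b.sum_repr v]
  rw [map_sum]
  refine Finset.sum_le_sum fun i _ => ?_
  obtain ⟨h0, h1⟩ := he (b i) (by simpa [b] using hs i.2)
  rw [map_smul, smul_eq_mul, Module.Basis.coord_apply]
  exact (mul_le_mul_of_nonneg_right (le_abs_self _) h0).trans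
    (mul_le_of_le_one_right (abs_nonneg _) h1)

/-- Proposition A.1: a pairwise distinguishable family of states in a finite-dimensional
state space is finite. -/
theorem pairwise_distinguishable_finite {V : Type*} [NormedAddCommGroup V]
    [NormedSpace ℝ V] [FiniteDimensional ℝ V]
    (Ω : Set V) (hΩ : IsStateSpace Ω) (C : Set V) (hC : C ⊆ Ω)
    (hdist : ∀ ω ∈ C, ∀ σ ∈ C, ω ≠ σ →
      ∃ e : V →ₗ[ℝ] ℝ, IsEffect Ω e ∧ e ω = 1 ∧ e σ = 0) :
    C.Finite := by
  obtain ⟨δ, hδ, hlt⟩ := exists_pos_forall_isEffect_lt_one hΩ.2.2.1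
  obtain ⟨t, ht, hcover⟩ := Metric.totallyBounded_iff.1 hΩ.1.totallyBounded (δ / 2) (half_pos hδ)
  refine (ht.biUnion (t := fun y => C ∩ Metric.ball y (δ / 2)) fun y _ =>
    Set.Subsingleton.finite ?_).subset fun x hx => ?_
  · rintro ω ⟨hω, hωy⟩ σ ⟨hσ, hσy⟩
    by_contra hne
    obtain ⟨e, he, h1, h0⟩ := hdist ω hω σ hσ hne
    have hd : ‖ω - σ‖ < δ := by
      rw [← dist_eq_norm]
      have := dist_triangle_right ω σ y
      rw [Metric.mem_ball] at hωy hσy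
      linarith
    have := hlt e he _ hd
    simp [h1, h0] at this
  · obtain ⟨y, hy, hxy⟩ := Set.mem_iUnion₂.1 (hcover (hC hx))
    exact Set.mem_iUnion₂.2 ⟨y, hy, hx, hxy⟩
end
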